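/- In the p-parking model on Z/nZ with m = n − 1 cars (n ≥ 2), for every vertex x ∈ Z/nZ: P(TL = {x}) = 1/n, and, conditionally on the event that no car chooses x as its starting vertex, P(TL = {x} | no car starts at x) = n^{n−2}/(n−1)^{n−1}. -/

import Mathlib

open Finset MeasureTheory Filter Asymptotics
open scoped Classical

namespace Golf

/-- Canonical position of a vertex of the cycle `Z/nZ` in `{1, …, n}`. -/
def cpos {n : ℕ} (v : Fin n) : ℕ := if v.val = 0 then n else v.val

/-- Shift a vertex by `d` steps in the positive direction. -/
def shiftR {n : ℕ} (v : Fin n) (d : ℕ) : Fin n :=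
  ⟨(v.val + d) % n, Nat.mod_lt _ (Nat.lt_of_le_of_lt (Nat.zero_le _) v.isLt)⟩

/-- Shift a vertex by `d` steps in the negative direction. -/
def shiftL {n : ℕ} (v : Fin n) (d : ℕ) : Fin n := shiftR v (n - d % n)

/-- Distance (in `[1, n]`) from `v` to the nearest element of `H` in the positive direction. -/
def distR {n : ℕ} (H : Finset (Fin n)) (v : Fin n) : ℕ :=
  if h : ((Finset.Icc 1 n).filter fun d => shiftR v d ∈ H).Nonempty then
    ((Finset.Icc 1 n).filter fun d => shiftR v d ∈ H).min' h
  else 0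

/-- Distance (in `[1, n]`) from `v` to the nearest element of `H` in the negative direction. -/
def distL {n : ℕ} (H : Finset (Fin n)) (v : Fin n) : ℕ :=
  if h : ((Finset.Icc 1 n).filter fun d => shiftL v d ∈ H).Nonempty then
    ((Finset.Icc 1 n).filter fun d => shiftL v d ∈ H).min' h
  else 0

/-- Probability that the ball activated at `v` fills the nearest free hole in the positive
direction, when the current set of free holes is `H`, for the `p`-biased random walk. -/
noncomputable def rightProb {n : ℕ} (p : ℝ) (H : Finset (Fin n)) (v : Fin n) : ℝ :=
  if p = 1 / 2 then (distL H v : ℝ) / ((distL H v : ℝ) + (distR H v : ℝ))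
  else (1 - ((1 - p) / p) ^ distL H v) / (1 - ((1 - p) / p) ^ (distL H v + distR H v))

/-- New set of free holes after the ball at `v` makes its choice
(`true` = fill the nearest free hole in the positive direction). -/
def golfStep {n : ℕ} (H : Finset (Fin n)) (v : Fin n) (choice : Bool) : Finset (Fin n) :=
  if choice then H.erase (shiftR v (distR H v)) else H.erase (shiftL v (distL H v))

/-- Final set of free holes after activating the listed balls with the listed choices. -/
def golfRun {n : ℕ} : List (Fin n) → List Bool → Finset (Fin n) → Finset (Fin n)
  | v :: vs, c :: cs, H => golfRun vs cs (golfStep H v c)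
  | _, _, H => H

/-- Probability of a given sequence of left/right choices. -/
noncomputable def golfWeight {n : ℕ} (p : ℝ) :
    List (Fin n) → List Bool → Finset (Fin n) → ℝ
  | v :: vs, c :: cs, H =>
      (if c then rightProb p H v else 1 - rightProb p H v) * golfWeight p vs cs (golfStep H v c)
  | _, _, _ => 1

/-- Initial data of the golf model: an initial configuration with `nb` balls (listed in their
activation order, encoded as an embedding `Fin nb ↪ Fin n`) and `nt` holes, the balls and holes
being on distinct vertices.  The initial configuration together with the activation order is
uniform on this set. -/
noncomputable def golfInit (n nb nt : ℕ) : Finset ((Fin nb ↪ Fin n) × Finset (Fin n)) :=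
  Finset.univ.filter fun fT => fT.2.card = nt ∧ ∀ i, fT.1 i ∉ fT.2

/-- Expectation of `g B⁰ T⁰ TL` in the golf model on `Z/nZ` with `nb` balls, `nt` holes and
walk parameter `p`, where `B⁰` is the initial set of balls, `T⁰` the initial set of holes and
`TL` the final set of free holes. -/
noncomputable def golfExp (n nb nt : ℕ) (p : ℝ)
    (g : Finset (Fin n) → Finset (Fin n) → Finset (Fin n) → ℝ) : ℝ :=
  (∑ fT ∈ golfInit n nb nt, ∑ cs : Fin nb → Bool,
      golfWeight p (List.ofFn ⇑fT.1) (List.ofFn cs) fT.2 *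
        g (Finset.univ.map fT.1) fT.2 (golfRun (List.ofFn ⇑fT.1) (List.ofFn cs) fT.2)) /
    (golfInit n nb nt).card

/-- `golfProb n nb nt p X` is the probability that the final set of free holes is `X`. -/
noncomputable def golfProb (n nb nt : ℕ) (p : ℝ) (X : Finset (Fin n)) : ℝ :=
  golfExp n nb nt p fun _ _ TL => if TL = X then 1 else 0

/-- Sorted list of the canonical positions of the elements of `X`. -/
def sortedPos {n : ℕ} (X : Finset (Fin n)) : List ℕ := (X.image cpos).sort (· ≤ ·)

/-- `blockSize X i` is the size `Δ_i X` of the `i`-th block of `X`. -/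
def blockSize {n : ℕ} (X : Finset (Fin n)) (i : ℕ) : ℕ :=
  let q := sortedPos X
  let k := q.length
  (q.getD (i % k) 0 + n - q.getD ((i + k - 1) % k) 0 - 1) % n

/-- `blockSet X i` is the `i`-th block `B_i` of `X`: the set of vertices strictly between
`x_i` and `x_{i+1}` in the positive direction. -/
def blockSet {n : ℕ} (X : Finset (Fin n)) (i : ℕ) : Finset (Fin n) :=
  let q := sortedPos X
  let k := q.length
  let lo := q.getD ((i + k - 1) % k) 0
  let hi := q.getD (i % k) 0
  Finset.univ.filter fun v =>
    if lo < hi then lo < cpos v ∧ cpos v < hi else cpos v < hi ∨ lo < cpos v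

/-- Size of the largest block of `X`. -/
def maxBlockSize {n : ℕ} (X : Finset (Fin n)) : ℕ :=
  (Finset.range X.card).sup (blockSize X)

/-- `multinom3 a b c` is the multinomial coefficient `(a+b+c)! / (a! b! c!)`. -/
def multinom3 (a b c : ℕ) : ℕ :=
  (a + b + c).factorial / (a.factorial * b.factorial * c.factorial)

end Golf

namespace Golf

/-- One parking step: the car starting at `v` parks there if `v` is free, and otherwise
follows its left/right choice towards the nearest free spot. -/
def parkStep {n : ℕ} (H : Finset (Fin n)) (v : Fin n) (choice : Bool) : Finset (Fin n) :=
  if v ∈ H then H.erase v else golfStep H v choice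

/-- Final set of free spots after the listed cars have parked. -/
def parkRun {n : ℕ} : List (Fin n) → List Bool → Finset (Fin n) → Finset (Fin n)
  | v :: vs, c :: cs, H => parkRun vs cs (parkStep H v c)
  | _, _, H => H

/-- Probability of a given sequence of left/right choices in the parking process
(a fair, unused coin is flipped for a car whose starting spot is free). -/
noncomputable def parkWeight {n : ℕ} (p : ℝ) :
    List (Fin n) → List Bool → Finset (Fin n) → ℝ
  | v :: vs, c :: cs, H =>
      (if v ∈ H then 1 / 2 else if c then rightProb p H v else 1 - rightProb p H v) *
        parkWeight p vs cs (parkStep H v c)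
  | _, _, _ => 1

/-- Expectation of `g vs TL` in the `p`-parking model on `Z/nZ` with `m` cars, where
`vs` is the sequence of starting vertices of the cars (i.i.d. uniform) and `TL` is the final
set of free spots. -/
noncomputable def parkExp (n m : ℕ) (p : ℝ)
    (g : (Fin m → Fin n) → Finset (Fin n) → ℝ) : ℝ :=
  (∑ vs : Fin m → Fin n, ∑ cs : Fin m → Bool,
      parkWeight p (List.ofFn vs) (List.ofFn cs) Finset.univ *
        g vs (parkRun (List.ofFn vs) (List.ofFn cs) Finset.univ)) /
    (n : ℝ) ^ m

/-- `parkProb n m p X` is the probability that the final set of free spots is `X`. -/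
noncomputable def parkProb (n m : ℕ) (p : ℝ) (X : Finset (Fin n)) : ℝ :=
  parkExp n m p fun _ TL => if TL = X then 1 else 0

end Golf

open Golf

namespace Golf

lemma exists_shiftR_eq {n : ℕ} (v w : Fin n) : ∃ d ∈ Finset.Icc 1 n, shiftR v d = w := by
  obtain ⟨v, hv⟩ := v
  obtain ⟨w, hw⟩ := w
  by_cases h : v < w
  · refine ⟨w - v, by simp only [Finset.mem_Icc]; omega, Fin.ext ?_⟩
    simp only [shiftR]
    rw [show v + (w - v) = w by omega, Nat.mod_eq_of_lt hw]
  · refine ⟨w + n - v, by simp only [Finset.mem_Icc]; omega, Fin.ext ?_⟩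
    simp only [shiftR]
    rw [show v + (w + n - v) = w + n by omega, Nat.add_mod_right, Nat.mod_eq_of_lt hw]

lemma exists_shiftL_eq {n : ℕ} (v w : Fin n) : ∃ d ∈ Finset.Icc 1 n, shiftL v d = w := by
  obtain ⟨d, hd, h⟩ := exists_shiftR_eq v w
  rw [Finset.mem_Icc] at hd
  rcases hd.2.eq_or_lt with rfl | hlt
  · exact ⟨d, by simp only [Finset.mem_Icc]; omega, by simpa [shiftL] using h⟩
  · refine ⟨n - d, by simp only [Finset.mem_Icc]; omega, ?_⟩
    rw [shiftL, Nat.mod_eq_of_lt (by omega : n - d < n), show n - (n - d) = d by omega, h]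

lemma shiftR_distR_mem {n : ℕ} {H : Finset (Fin n)} (hH : H.Nonempty) (v : Fin n) :
    shiftR v (distR H v) ∈ H := by
  obtain ⟨w, hw⟩ := hH
  obtain ⟨d, hd, h⟩ := exists_shiftR_eq v w
  have hne : ((Finset.Icc 1 n).filter fun d => shiftR v d ∈ H).Nonempty :=
    ⟨d, Finset.mem_filter.2 ⟨hd, h ▸ hw⟩⟩
  rw [distR, dif_pos hne]
  exact (Finset.mem_filter.1 (Finset.min'_mem _ hne)).2

lemma shiftL_distL_mem {n : ℕ} {H : Finset (Fin n)} (hH : H.Nonempty) (v : Fin n) :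
    shiftL v (distL H v) ∈ H := by
  obtain ⟨w, hw⟩ := hH
  obtain ⟨d, hd, h⟩ := exists_shiftL_eq v w
  have hne : ((Finset.Icc 1 n).filter fun d => shiftL v d ∈ H).Nonempty :=
    ⟨d, Finset.mem_filter.2 ⟨hd, h ▸ hw⟩⟩
  rw [distL, dif_pos hne]
  exact (Finset.mem_filter.1 (Finset.min'_mem _ hne)).2

lemma card_parkStep {n : ℕ} {H : Finset (Fin n)} (hH : H.Nonempty) (v : Fin n) (c : Bool) :
    (parkStep H v c).card = H.card - 1 := by
  unfold parkStep golfStep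
  split_ifs with h
  · exact Finset.card_erase_of_mem h
  · exact Finset.card_erase_of_mem (shiftR_distR_mem hH v)
  · exact Finset.card_erase_of_mem (shiftL_distL_mem hH v)

lemma parkStep_subset {n : ℕ} (H : Finset (Fin n)) (v : Fin n) (c : Bool) :
    parkStep H v c ⊆ H.erase v := by
  unfold parkStep golfStep
  split_ifs with h
  · exact subset_rfl
  · rw [Finset.erase_eq_of_notMem h]
    exact Finset.erase_subset _ _
  · rw [Finset.erase_eq_of_notMem h]
    exact Finset.erase_subset _ _

lemma card_parkRun {n : ℕ} (vs : List (Fin n)) (cs : List Bool) (H : Finset (Fin n))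
    (hlen : cs.length = vs.length) (hH : vs.length ≤ H.card) :
    (parkRun vs cs H).card = H.card - vs.length := by
  induction vs generalizing cs H with
  | nil => simp [parkRun]
  | cons v vs ih =>
    obtain _ | ⟨c, cs⟩ := cs
    · simp at hlen
    · simp only [List.length_cons, add_left_inj] at hlen hH
      have hc := card_parkStep (Finset.card_pos.1 (by omega : 0 < H.card)) v c
      rw [parkRun, ih cs _ hlen (by omega), hc, List.length_cons]
      omega

lemma parkRun_subset {n : ℕ} (vs : List (Fin n)) (cs : List Bool) (H : Finset (Fin n)) :
    parkRun vs cs H ⊆ H := by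
  induction vs generalizing cs H with
  | nil => simp [parkRun]
  | cons v vs ih =>
    obtain _ | ⟨c, cs⟩ := cs
    · simp [parkRun]
    · exact (ih cs _).trans ((parkStep_subset H v c).trans (Finset.erase_subset _ _))

lemma notMem_parkRun_of_mem {n : ℕ} (vs : List (Fin n)) (cs : List Bool) (H : Finset (Fin n))
    (hlen : cs.length = vs.length) {x : Fin n} (hx : x ∈ vs) : x ∉ parkRun vs cs H := by
  induction vs generalizing cs H with
  | nil => simp at hx
  | cons v vs ih =>
    obtain _ | ⟨c, cs⟩ := cs
    · simp at hlen
    · simp only [List.length_cons, add_left_inj] at hlen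
      rcases List.mem_cons.1 hx with rfl | hx
      · intro h
        simpa using parkStep_subset H x c (parkRun_subset _ _ _ h)
      · exact ih cs _ hlen hx

lemma sum_parkWeight {n m : ℕ} (p : ℝ) (vs : Fin m → Fin n) (H : Finset (Fin n)) :
    ∑ cs : Fin m → Bool, parkWeight p (List.ofFn vs) (List.ofFn cs) H = 1 := by
  induction m generalizing H with
  | zero => simp [parkWeight]
  | succ m ih =>
    rw [← (Fin.consEquiv fun _ : Fin (m + 1) => Bool).sum_comp, Fintype.sum_prod_type]
    simp only [Fin.consEquiv_apply, List.ofFn_succ, Fin.cons_zero, Fin.cons_succ, parkWeight,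
      ← Finset.mul_sum, ih, mul_one, Fintype.sum_bool]
    split_ifs <;> simp_all <;> norm_num

lemma distR_map {n : ℕ} (e : Fin n ≃ Fin n) (he : ∀ v d, e (shiftR v d) = shiftR (e v) d)
    (H : Finset (Fin n)) (v : Fin n) : distR (H.map e.toEmbedding) (e v) = distR H v := by
  have hmem : ∀ w, e w ∈ H.map e.toEmbedding ↔ w ∈ H := fun w => by simp
  simp only [distR, ← he, hmem]

lemma distL_map {n : ℕ} (e : Fin n ≃ Fin n) (he : ∀ v d, e (shiftR v d) = shiftR (e v) d)
    (H : Finset (Fin n)) (v : Fin n) : distL (H.map e.toEmbedding) (e v) = distL H v := by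
  have hmem : ∀ w, e w ∈ H.map e.toEmbedding ↔ w ∈ H := fun w => by simp
  have hL : ∀ v d, e (shiftL v d) = shiftL (e v) d := fun v d => he v _
  simp only [distL, ← hL, hmem]

lemma map_parkStep {n : ℕ} (e : Fin n ≃ Fin n) (he : ∀ v d, e (shiftR v d) = shiftR (e v) d)
    (H : Finset (Fin n)) (v : Fin n) (c : Bool) :
    parkStep (H.map e.toEmbedding) (e v) c = (parkStep H v c).map e.toEmbedding := by
  have hmem : ∀ w, e w ∈ H.map e.toEmbedding ↔ w ∈ H := fun w => by simp
  have hL : ∀ v d, e (shiftL v d) = shiftL (e v) d := fun v d => he v _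
  have hR' := distR_map e he H v
  have hL' := distL_map e he H v
  simp only [parkStep, golfStep, hmem, hR', hL', ← he, ← hL]
  split_ifs <;> rw [Finset.map_erase] <;> rfl

lemma parkRun_map {n : ℕ} (e : Fin n ≃ Fin n) (he : ∀ v d, e (shiftR v d) = shiftR (e v) d)
    (vs : List (Fin n)) (cs : List Bool) (H : Finset (Fin n)) :
    parkRun (vs.map e) cs (H.map e.toEmbedding) = (parkRun vs cs H).map e.toEmbedding := by
  induction vs generalizing cs H with
  | nil => simp [parkRun]
  | cons v vs ih =>
    obtain _ | ⟨c, cs⟩ := cs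
    · simp [parkRun]
    · rw [List.map_cons, parkRun, map_parkStep e he, ih, parkRun]

lemma parkWeight_map {n : ℕ} (e : Fin n ≃ Fin n) (he : ∀ v d, e (shiftR v d) = shiftR (e v) d)
    (p : ℝ) (vs : List (Fin n)) (cs : List Bool) (H : Finset (Fin n)) :
    parkWeight p (vs.map e) cs (H.map e.toEmbedding) = parkWeight p vs cs H := by
  induction vs generalizing cs H with
  | nil => simp [parkWeight]
  | cons v vs ih =>
    obtain _ | ⟨c, cs⟩ := cs
    · simp [parkWeight]
    · have hmem : e v ∈ H.map e.toEmbedding ↔ v ∈ H := by simp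
      simp only [List.map_cons, parkWeight, map_parkStep e he, ih, hmem, rightProb,
        distR_map e he, distL_map e he]

lemma parkProb_map {n : ℕ} (e : Fin n ≃ Fin n) (he : ∀ v d, e (shiftR v d) = shiftR (e v) d)
    (m : ℕ) (p : ℝ) (X : Finset (Fin n)) :
    parkProb n m p (X.map e.toEmbedding) = parkProb n m p X := by
  have hu : (Finset.univ : Finset (Fin n)) = Finset.univ.map e.toEmbedding := by simp
  unfold parkProb parkExp
  rw [← (Equiv.arrowCongr (Equiv.refl (Fin m)) e).sum_comp]
  congr 1
  refine Finset.sum_congr rfl fun vs _ => Finset.sum_congr rfl fun cs _ => ?_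
  have hl : List.ofFn ((Equiv.arrowCongr (Equiv.refl (Fin m)) e) vs) = (List.ofFn vs).map e := by
    rw [List.map_ofFn]
    rfl
  rw [hl]
  nth_rewrite 1 [hu]
  nth_rewrite 2 [hu]
  rw [parkWeight_map e he, parkRun_map e he]
  simp only [Finset.map_inj]

lemma exists_rotation {n : ℕ} (x y : Fin n) :
    ∃ e : Fin n ≃ Fin n, (∀ v d, e (shiftR v d) = shiftR (e v) d) ∧ e x = y := by
  obtain _ | n := n
  · exact x.elim0
  · refine ⟨Equiv.addRight (y - x), fun v d => Fin.ext ?_, by simp⟩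
    simp only [Equiv.coe_addRight, shiftR, Fin.val_add, Nat.mod_add_mod]
    congr 1
    omega

lemma parkProb_singleton_eq {n : ℕ} (m : ℕ) (p : ℝ) (x y : Fin n) :
    parkProb n m p {x} = parkProb n m p {y} := by
  obtain ⟨e, he, rfl⟩ := exists_rotation x y
  rw [← parkProb_map e he m p {x}, Finset.map_singleton, Equiv.coe_toEmbedding]

lemma sum_parkProb_singleton {n : ℕ} (hn : 1 ≤ n) (p : ℝ) :
    ∑ y : Fin n, parkProb n (n - 1) p {y} = 1 := by
  have h : ∀ (vs : Fin (n - 1) → Fin n) (cs : Fin (n - 1) → Bool),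
      ∑ y : Fin n, (if parkRun (List.ofFn vs) (List.ofFn cs) Finset.univ = {y} then (1 : ℝ)
        else 0) = 1 := by
    intro vs cs
    have hc := card_parkRun (List.ofFn vs) (List.ofFn cs) Finset.univ (by simp) (by simp)
    rw [List.length_ofFn, Finset.card_univ, Fintype.card_fin, Nat.sub_sub_self hn] at hc
    obtain ⟨z, hz⟩ := Finset.card_eq_one.1 hc
    simp [hz]
  unfold parkProb parkExp
  rw [← Finset.sum_div, Finset.sum_comm]
  simp_rw [Finset.sum_comm (s := (Finset.univ : Finset (Fin n)))
    (t := (Finset.univ : Finset (Fin (n - 1) → Bool))), ← Finset.mul_sum, h, mul_one,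
    sum_parkWeight]
  have : (n : ℝ) ≠ 0 := by positivity
  simp [this]

lemma parkProb_singleton {n : ℕ} (hn : 1 ≤ n) (p : ℝ) (x : Fin n) :
    parkProb n (n - 1) p {x} = 1 / n := by
  have h := sum_parkProb_singleton hn p
  rw [Finset.sum_congr rfl fun y _ => parkProb_singleton_eq (n - 1) p y x] at h
  have : (n : ℝ) ≠ 0 := by positivity
  rw [eq_div_iff this, mul_comm]
  simpa using h

lemma parkExp_singleton_and_avoid {n : ℕ} (m : ℕ) (p : ℝ) (x : Fin n) :
    (parkExp n m p fun vs TL => if TL = {x} ∧ ∀ i, vs i ≠ x then 1 else 0) =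
      parkProb n m p {x} := by
  unfold parkProb parkExp
  congr 1
  refine Finset.sum_congr rfl fun vs _ => Finset.sum_congr rfl fun cs _ => ?_
  congr 1
  refine if_congr (and_iff_left_of_imp fun h i hi => ?_) rfl rfl
  exact notMem_parkRun_of_mem (List.ofFn vs) (List.ofFn cs) Finset.univ (by simp)
    ((List.mem_ofFn' _ _).2 ⟨i, hi⟩) (h ▸ Finset.mem_singleton_self x)

lemma parkExp_avoid {n : ℕ} (m : ℕ) (p : ℝ) (x : Fin n) :
    (parkExp n m p fun vs _ => if ∀ i, vs i ≠ x then 1 else 0) =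
      ((n : ℝ) - 1) ^ m / (n : ℝ) ^ m := by
  have hcard : (Finset.univ.filter fun vs : Fin m → Fin n => ∀ i, vs i ≠ x) =
      Fintype.piFinset fun _ => Finset.univ.erase x := by
    ext vs
    simp
  unfold parkExp
  simp_rw [← Finset.sum_mul, sum_parkWeight, one_mul]
  rw [Finset.sum_boole, hcard, Fintype.card_piFinset_const, Finset.card_erase_of_mem
    (Finset.mem_univ x), Finset.card_univ, Fintype.card_fin, Nat.cast_pow,
    Nat.cast_sub (by have := x.isLt; omega), Nat.cast_one]

end Golf

/-- **The almost-full parking case** (Equation (25) of the paper).  In the `p`-parking model on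
`Z/nZ` with `m = n - 1` cars, for every vertex `x`, `P(TL = {x}) = 1/n` and
`P(TL = {x} | no car starts at x) = n^{n-2}/(n-1)^{n-1}`. -/
theorem parking_one_spot_law (n : ℕ) (hn : 2 ≤ n)
    (p : ℝ) (hp0 : 0 < p) (hp1 : p < 1) (x : Fin n) :
    parkProb n (n - 1) p {x} = 1 / n ∧
    (parkExp n (n - 1) p fun vs TL => if TL = {x} ∧ ∀ i, vs i ≠ x then 1 else 0) /
        (parkExp n (n - 1) p fun vs _ => if ∀ i, vs i ≠ x then 1 else 0) =
      (n : ℝ) ^ (n - 2) / ((n : ℝ) - 1) ^ (n - 1) := by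
  refine ⟨parkProb_singleton (by omega) p x, ?_⟩
  rw [parkExp_singleton_and_avoid, parkProb_singleton (by omega), parkExp_avoid]
  obtain ⟨k, rfl⟩ := Nat.exists_eq_add_of_le' hn
  have h0 : ((k + 2 : ℕ) : ℝ) ≠ 0 := by positivity
  rw [show k + 2 - 1 = k + 1 by omega, show k + 2 - 2 = k by omega, pow_succ, one_div,
    div_div_eq_mul_div, inv_mul_eq_div]
  simp only [pow_succ]
  rw [mul_div_cancel_right₀ _ h0]
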